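/- In the setting of the equivariance of multi-head attention to structured permutations — X ∈ ℝ^{S×d_m}, W_q, W_k, W_v ∈ ℝ^{d_m×d_m}, d_m = H·d_k, per-head attention A_i = softmax(Q_i K_iᵀ/√d_k) applied row-wise, outputs O (from W_q, W_k, W_v) and O' (from W_q P_attn, W_k P_attn, W_v P_attn), where P_attn = Σ_{i=1}^{H} E^{i,π(i)} ⊗ P^{(i)} for a head permutation π and intra-head permutation matrices P^{(i)} — the original attention output is recovered from the permuted one via O = O' P_attnᵀ. -/

import Mathlib

open Matrix Kronecker

/-- The permutation matrix associated with a permutation `σ`: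
`(P_σ)_{u,v} = 1` if `u = σ v` and `0` otherwise. -/
def permMatrix {ι : Type*} [DecidableEq ι] (σ : Equiv.Perm ι) : Matrix ι ι ℝ :=
  Matrix.of fun u v => if u = σ v then (1 : ℝ) else 0

/-- The block permutation `P_attn = Σ_{i} E^{i,π(i)} ⊗ P^{(i)}`. -/
def Pattn {H dk : ℕ} (π : Equiv.Perm (Fin H)) (ρ : Fin H → Equiv.Perm (Fin dk)) :
    Matrix (Fin H × Fin dk) (Fin H × Fin dk) ℝ :=
  ∑ i : Fin H, (Matrix.single i (π i) (1 : ℝ)) ⊗ₖ permMatrix (ρ i)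

/-- The `i`-th column block (an `S × d_k` matrix) of an `S × (H·d_k)` matrix whose
columns are indexed by pairs `(head index, within-head index)`. -/
def blockCol {S H dk : ℕ} (Q : Matrix (Fin S) (Fin H × Fin dk) ℝ) (i : Fin H) :
    Matrix (Fin S) (Fin dk) ℝ :=
  Matrix.of fun s a => Q s (i, a)

/-- Row-wise softmax of a real `S × S` matrix:
`softmax(M)_{ij} = exp(M_{ij}) / Σ_k exp(M_{ik})`. -/
noncomputable def softmax {S : ℕ} (M : Matrix (Fin S) (Fin S) ℝ) :
    Matrix (Fin S) (Fin S) ℝ :=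
  Matrix.of fun i j => Real.exp (M i j) / ∑ k, Real.exp (M i k)

/-- Multi-head attention output: with `Q = X W_q`, `K = X W_k`, `V = X W_v` split into
`H` column blocks of width `d_k`, per-head attention `A_i = softmax(Q_i K_iᵀ / √d_k)`
(row-wise) and per-head outputs `O_i = A_i V_i`, this is the `S × (H·d_k)` matrix whose
`i`-th column block is `O_i`. -/
noncomputable def MHA {S H dk : ℕ} (X : Matrix (Fin S) (Fin H × Fin dk) ℝ)
    (Wq Wk Wv : Matrix (Fin H × Fin dk) (Fin H × Fin dk) ℝ) :
    Matrix (Fin S) (Fin H × Fin dk) ℝ :=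
  Matrix.of fun s p =>
    (softmax ((1 / Real.sqrt (dk : ℝ)) •
        (blockCol (X * Wq) p.1 * (blockCol (X * Wk) p.1)ᵀ)) *
      blockCol (X * Wv) p.1) s p.2

lemma Pattn_apply {H dk : ℕ} (π : Equiv.Perm (Fin H)) (ρ : Fin H → Equiv.Perm (Fin dk))
    (p q : Fin H × Fin dk) :
    Pattn π ρ p q = if q = (π p.1, (ρ p.1).symm p.2) then (1 : ℝ) else 0 := by
  obtain ⟨i, a⟩ := p
  obtain ⟨j, b⟩ := q
  unfold Pattn
  rw [Matrix.sum_apply, Finset.sum_eq_single i]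
  · simp only [Matrix.kroneckerMap_apply, Matrix.single_apply, permMatrix, Matrix.of_apply,
      Prod.mk.injEq, Equiv.eq_symm_apply, true_and]
    by_cases h1 : π i = j
    · by_cases h2 : a = ρ i b
      · simp [h1, h2]
      · simp [h2, Ne.symm h2]
    · simp [h1, Ne.symm h1]
  · intro k _ hk
    simp [Matrix.kroneckerMap_apply, Matrix.single_apply, hk]
  · simp

lemma mul_Pattn_transpose {S H dk : ℕ} (M : Matrix (Fin S) (Fin H × Fin dk) ℝ)
    (π : Equiv.Perm (Fin H)) (ρ : Fin H → Equiv.Perm (Fin dk)) (s : Fin S)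
    (p : Fin H × Fin dk) :
    (M * (Pattn π ρ)ᵀ) s p = M s (π p.1, (ρ p.1).symm p.2) := by
  simp [Matrix.mul_apply, Pattn_apply]

lemma mul_Pattn {S H dk : ℕ} (M : Matrix (Fin S) (Fin H × Fin dk) ℝ)
    (π : Equiv.Perm (Fin H)) (ρ : Fin H → Equiv.Perm (Fin dk)) (s : Fin S)
    (i : Fin H) (b : Fin dk) :
    (M * Pattn π ρ) s (π i, b) = M s (i, ρ i b) := by
  rw [Matrix.mul_apply, Finset.sum_eq_single (i, ρ i b)]
  · simp [Pattn_apply]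
  · rintro ⟨j, a⟩ _ h
    rw [Pattn_apply, if_neg, mul_zero]
    intro h'
    simp only [Prod.mk.injEq, EmbeddingLike.apply_eq_iff_eq, Equiv.eq_symm_apply] at h'
    obtain ⟨rfl, h2⟩ := h'
    exact h (by rw [h2])
  · simp

lemma blockCol_mul_Pattn {S H dk : ℕ} (M : Matrix (Fin S) (Fin H × Fin dk) ℝ)
    (π : Equiv.Perm (Fin H)) (ρ : Fin H → Equiv.Perm (Fin dk)) (i : Fin H) :
    blockCol (M * Pattn π ρ) (π i) = (blockCol M i).submatrix id (ρ i) := by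
  ext s b
  simp [blockCol, mul_Pattn]

/-- In the setting of the equivariance of multi-head attention to
structured permutations, the original attention output `O` (computed from `W_q, W_k, W_v`)
is recovered from the permuted one `O'` (computed from `W_q P_attn, W_k P_attn, W_v P_attn`)
via `O = O' P_attnᵀ`. -/
theorem mha_output_recovered {S H dk : ℕ} (hH : 1 ≤ H)
    (X : Matrix (Fin S) (Fin H × Fin dk) ℝ)
    (Wq Wk Wv : Matrix (Fin H × Fin dk) (Fin H × Fin dk) ℝ)
    (π : Equiv.Perm (Fin H)) (ρ : Fin H → Equiv.Perm (Fin dk)) :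
    MHA X Wq Wk Wv =
      MHA X (Wq * Pattn π ρ) (Wk * Pattn π ρ) (Wv * Pattn π ρ) * (Pattn π ρ)ᵀ := by
  ext s p
  obtain ⟨i, a⟩ := p
  rw [mul_Pattn_transpose]
  simp only [MHA, Matrix.of_apply, ← Matrix.mul_assoc, blockCol_mul_Pattn,
    Matrix.transpose_submatrix, Matrix.submatrix_mul_equiv, Matrix.submatrix_id_id]
  simp [Matrix.mul_apply]
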